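/- arXiv:1906.08179 — 4 statements merged into one kernel-verified Lean document; each statement's English description precedes it below -/
import Mathlib

section
/- The ℤ-linear map from ℤ[X] ⊕ ℤ[X] to the Laurent polynomial ring ℤ[t,t⁻¹] sending a pair (g₁, g₂) of integer polynomials to g₁(t+t⁻¹) + t·g₂(t+t⁻¹) is bijective. Equivalently, every Laurent polynomial f ∈ ℤ[t,t⁻¹] can be written uniquely as f = g₁ + t·g₂ with g₁, g₂ elements of the subring ℤ[t+t⁻¹] generated over ℤ by t+t⁻¹. -/
open LaurentPolynomial

namespace LaurentPolynomial

theorem transcendental_T_one (R : Type*) [CommRing R] :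
    Transcendental R (T 1 : R[T;T⁻¹]) := by
  rw [transcendental_iff_injective]
  convert Polynomial.toLaurent_injective (R := R) using 1
  ext1 p
  have h : Polynomial.aeval (T 1 : R[T;T⁻¹]) = Polynomial.toLaurentAlg := by
    ext1
    simp
  simp [h]

theorem transcendental_T_one_add_T_neg_one (R : Type*) [CommRing R] [IsDomain R] :
    Transcendental R (T 1 + T (-1) : R[T;T⁻¹]) := by
  intro hs
  refine transcendental_T_one R ?_
  let s : Subalgebra.algebraicClosure R R[T;T⁻¹] := ⟨_, hs⟩
  have ht : IsAlgebraic (Subalgebra.algebraicClosure R R[T;T⁻¹]) (T 1 : R[T;T⁻¹]) := by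
    refine ⟨Polynomial.X ^ 2 - Polynomial.C s * Polynomial.X + 1, fun h => ?_, ?_⟩
    · simpa using congrArg (Polynomial.coeff · 0) h
    · have hs' : algebraMap (Subalgebra.algebraicClosure R R[T;T⁻¹]) R[T;T⁻¹] s =
        T 1 + T (-1) := rfl
      simp only [map_add, map_sub, map_mul, map_pow, map_one, Polynomial.aeval_X,
        Polynomial.aeval_C, hs']
      have h : (T 1 : R[T;T⁻¹]) * T (-1) = 1 := by rw [← T_add]; simp
      linear_combination -h
  exact ht.restrictScalars R

theorem T_one_ne_T_neg_one (R : Type*) [CommRing R] [Nontrivial R] :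
    (T 1 : R[T;T⁻¹]) ≠ T (-1) := by
  intro h
  simpa using congrArg (fun f : R[T;T⁻¹] => f.coeff 1) h

theorem invert_aeval_T_one_add_T_neg_one {R : Type*} [CommRing R] (p : Polynomial R) :
    invert (Polynomial.aeval (T 1 + T (-1) : R[T;T⁻¹]) p) =
      Polynomial.aeval (T 1 + T (-1) : R[T;T⁻¹]) p := by
  have h := Polynomial.aeval_algHom_apply (invert (R := R)) (T 1 + T (-1) : R[T;T⁻¹]) p
  rw [← h]
  simp [add_comm]

theorem injective_aeval_add_T_one_mul_aeval (R : Type*) [CommRing R] [IsDomain R] :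
    Function.Injective (fun g : Polynomial R × Polynomial R =>
      Polynomial.aeval (T 1 + T (-1) : R[T;T⁻¹]) g.1 +
        T 1 * Polynomial.aeval (T 1 + T (-1) : R[T;T⁻¹]) g.2) := by
  rintro ⟨a, b⟩ ⟨c, d⟩ h
  have hinj := transcendental_iff_injective.mp (transcendental_T_one_add_T_neg_one R)
  simp only at h
  have h' := congrArg invert h
  simp only [map_add, map_mul, invert_aeval_T_one_add_T_neg_one, invert_T] at h'
  have hbd := mul_left_cancel₀ (sub_ne_zero.mpr (T_one_ne_T_neg_one R))
    (show (T 1 - T (-1)) * Polynomial.aeval (T 1 + T (-1) : R[T;T⁻¹]) b =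
      (T 1 - T (-1)) * Polynomial.aeval (T 1 + T (-1) : R[T;T⁻¹]) d by
      linear_combination h - h')
  rw [hbd] at h
  exact Prod.ext (hinj (add_right_cancel h)) (hinj hbd)

theorem surjective_aeval_add_T_one_mul_aeval (R : Type*) [CommRing R] :
    Function.Surjective (fun g : Polynomial R × Polynomial R =>
      Polynomial.aeval (T 1 + T (-1) : R[T;T⁻¹]) g.1 +
        T 1 * Polynomial.aeval (T 1 + T (-1) : R[T;T⁻¹]) g.2) := by
  have hT : (T 1 : R[T;T⁻¹]) * T (-1) = 1 := by rw [← T_add]; simp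
  intro f
  induction f using LaurentPolynomial.induction_on with
  | h_C a => exact ⟨(Polynomial.C a, 0), by
      simp only [Polynomial.aeval_C, map_zero, mul_zero, add_zero, C_eq_algebraMap]⟩
  | h_add hp hq =>
    obtain ⟨g, rfl⟩ := hp
    obtain ⟨k, rfl⟩ := hq
    refine ⟨g + k, ?_⟩
    simp only [Prod.fst_add, Prod.snd_add, map_add]
    ring
  | h_C_mul_T n a ih =>
    obtain ⟨⟨p, q⟩, h⟩ := ih
    refine ⟨(-q, p + Polynomial.X * q), ?_⟩
    rw [T_add, ← mul_assoc, ← h]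
    simp only [map_add, map_neg, map_mul, Polynomial.aeval_X]
    linear_combination Polynomial.aeval (T 1 + T (-1) : R[T;T⁻¹]) q * hT
  | h_C_mul_T_Z n a ih =>
    obtain ⟨⟨p, q⟩, h⟩ := ih
    refine ⟨(Polynomial.X * p + q, -p), ?_⟩
    rw [T_sub, ← mul_assoc, ← h]
    simp only [map_add, map_neg, map_mul, Polynomial.aeval_X]
    linear_combination -Polynomial.aeval (T 1 + T (-1) : R[T;T⁻¹]) q * hT

end LaurentPolynomial

/-- The ℤ-linear map `ℤ[X] ⊕ ℤ[X] → ℤ[t,t⁻¹]`, `(g₁, g₂) ↦ g₁(t+t⁻¹) + t·g₂(t+t⁻¹)`,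
is bijective: every Laurent polynomial is uniquely `g₁ + t·g₂` with `g₁, g₂ ∈ ℤ[t+t⁻¹]`. -/
theorem laurent_free_rank_two_over_symmetric :
    Function.Bijective (fun g : Polynomial ℤ × Polynomial ℤ =>
      Polynomial.aeval (T 1 + T (-1) : LaurentPolynomial ℤ) g.1 +
        T 1 * Polynomial.aeval (T 1 + T (-1) : LaurentPolynomial ℤ) g.2) := by
  exact ⟨injective_aeval_add_T_one_mul_aeval ℤ, surjective_aeval_add_T_one_mul_aeval ℤ⟩
end

section
/- Let α be the ℤ-algebra involution of A = ℤ[t,t⁻¹] with α(t) = t⁻¹, let B ⊆ A be the fixed subring of α, and let f ∈ A satisfy α(f) ≠ f. Let g₁, g₂ ∈ B be the unique elements with (t⁻¹−t)·g₁ = t⁻¹·f − t·α(f) and (t⁻¹−t)·g₂ = α(f) − f (so g₂ ≠ 0). Set u := f·α(f) ∈ B and let R be the localization of B at the multiplicative set of powers of u, with ḡ₁, ḡ₂ the images of g₁, g₂ in R. Then the R-linear map d : R ⊕ R → R ⊕ R given by d(x₀, x₁) = (x₀ − ḡ₁·x₁, −ḡ₂·x₁) is injective, and its cokernel is isomorphic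 as an R-module to R/(ḡ₂), the quotient of R by the principal ideal generated by ḡ₂. -/
open LaurentPolynomial

/-- Over any commutative ring, the upper triangular map `(x₀, x₁) ↦ (x₀ - a x₁, -b x₁)` is
injective as soon as `b` is a non-zero-divisor. -/
theorem injective_of_apply_eq_sub_mul_neg_mul {R : Type*} [CommRing R] {a b : R}
    (hb : b ∈ nonZeroDivisors R) (d : (R × R) →ₗ[R] R × R)
    (hd : ∀ x, d x = (x.1 - a * x.2, -(b * x.2))) :
    Function.Injective d := by
  rw [injective_iff_map_eq_zero]
  rintro ⟨x, y⟩ h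
  rw [hd, Prod.mk_eq_zero, neg_eq_zero] at h
  obtain ⟨hx, hy⟩ := h
  have hy0 : y = 0 := (mem_nonZeroDivisors_iff.mp hb).1 y hy
  simp_all

/-- The kernel of the second projection to `R ⧸ (b)` is the range of the upper triangular map
`(x₀, x₁) ↦ (x₀ - a x₁, -b x₁)`. -/
theorem range_eq_ker_mkQ_comp_snd {R : Type*} [CommRing R] {a b : R}
    (d : (R × R) →ₗ[R] R × R) (hd : ∀ x, d x = (x.1 - a * x.2, -(b * x.2))) :
    LinearMap.range d =
      LinearMap.ker ((Submodule.mkQ (Ideal.span {b})).comp (LinearMap.snd R R R)) := by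
  ext ⟨x, y⟩
  simp only [LinearMap.mem_range, LinearMap.mem_ker, LinearMap.comp_apply, LinearMap.snd_apply,
    Submodule.mkQ_apply, Submodule.Quotient.mk_eq_zero, Ideal.mem_span_singleton, hd,
    Prod.mk.injEq]
  constructor
  · rintro ⟨z, -, rfl⟩
    exact (dvd_mul_right b z.2).neg_right
  · rintro ⟨c, rfl⟩
    exact ⟨(x - a * c, -c), by ring, by ring⟩

/-- The cokernel of the upper triangular map `(x₀, x₁) ↦ (x₀ - a x₁, -b x₁)` is `R ⧸ (b)`. -/
theorem nonempty_quotient_range_equiv_quotient_span {R : Type*} [CommRing R] {a b : R}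
    (d : (R × R) →ₗ[R] R × R) (hd : ∀ x, d x = (x.1 - a * x.2, -(b * x.2))) :
    Nonempty (((R × R) ⧸ LinearMap.range d) ≃ₗ[R] (R ⧸ Ideal.span {b})) :=
  ⟨(Submodule.quotEquivOfEq _ _ (range_eq_ker_mkQ_comp_snd d hd)).trans
    (LinearMap.quotKerEquivOfSurjective _
      ((Submodule.mkQ_surjective _).comp LinearMap.snd_surjective))⟩

/-- The algebraic content of the computation of the equivariant higher twisted K-theory of
`SU(2)`.  `α` is the ℤ-algebra involution of `A = ℤ[t,t⁻¹]` with `α(t) = t⁻¹`, `B` its fixed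
subring (realized as a commutative ring `B` embedded in `A` via `ι` with image exactly the
fixed points of `α`), `f ∈ A` with `α(f) ≠ f`, `g₁, g₂ ∈ B` the unique elements with
`(t⁻¹−t)·g₁ = t⁻¹·f − t·α(f)` and `(t⁻¹−t)·g₂ = α(f) − f`, `u = f·α(f) ∈ B`, and
`R = B_u` the localization of `B` at the powers of `u`.  Then the `R`-linear map
`d(x₀,x₁) = (x₀ − ḡ₁·x₁, −ḡ₂·x₁)` on `R ⊕ R` is injective and its cokernel is isomorphic,
as an `R`-module, to `R/(ḡ₂)`. -/
theorem su2_differential_injective_and_cokernel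
    (α : LaurentPolynomial ℤ →ₐ[ℤ] LaurentPolynomial ℤ)
    (hα : α (T 1) = T (-1))
    (B : Type) [CommRing B] (ι : B →+* LaurentPolynomial ℤ)
    (hι : Function.Injective ι)
    (hB : ∀ x : LaurentPolynomial ℤ, (∃ b, ι b = x) ↔ α x = x)
    (f : LaurentPolynomial ℤ) (hf : α f ≠ f)
    (g₁ g₂ : B)
    (hg₁ : (T (-1) - T 1) * ι g₁ = T (-1) * f - T 1 * α f)
    (hg₂ : (T (-1) - T 1) * ι g₂ = α f - f)
    (u : B) (hu : ι u = f * α f)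
    (d : (Localization.Away u × Localization.Away u) →ₗ[Localization.Away u]
         Localization.Away u × Localization.Away u)
    (hd : ∀ x : Localization.Away u × Localization.Away u,
      d x = (x.1 - algebraMap B (Localization.Away u) g₁ * x.2,
             -(algebraMap B (Localization.Away u) g₂ * x.2))) :
    Function.Injective d ∧
    Nonempty (((Localization.Away u × Localization.Away u) ⧸ LinearMap.range d)
      ≃ₗ[Localization.Away u]
        (Localization.Away u ⧸ Ideal.span {algebraMap B (Localization.Away u) g₂})) := by
  have : IsDomain B := hι.isDomain ι
  have hg₂0 : g₂ ≠ 0 := by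
    rintro rfl
    rw [map_zero, mul_zero] at hg₂
    exact hf (sub_eq_zero.mp hg₂.symm)
  have hb : algebraMap B (Localization.Away u) g₂ ∈ nonZeroDivisors (Localization.Away u) :=
    IsLocalization.map_nonZeroDivisors_le (Submonoid.powers u) (Localization.Away u)
      (Submonoid.mem_map_of_mem _ (mem_nonZeroDivisors_of_ne_zero hg₂0))
  exact ⟨injective_of_apply_eq_sub_mul_neg_mul hb d hd,
    nonempty_quotient_range_equiv_quotient_span d hd⟩
end

section
/- Let k ≥ 1 and let b₁, …, b_k be integers. In the Laurent polynomial ring ℤ[t,t⁻¹] the following identity holds: ∏_{i=1}^{k}(1 + b_i·t) − ∏_{i=1}^{k}(1 + b_i·t⁻¹) = (t − t⁻¹) · Σ_{ℓ=1}^{k} e_ℓ(b₁,…,b_k) · χ_{ℓ−1}, where e_ℓ(b₁,…,b_k) = Σ_{I ⊆ {1,…,k}, |I|=ℓ} ∏_{i∈I} b_i is the ℓ-th elementary symmetric polynomial evaluated at b₁,…,b_k, and χ_m := Σ_{j=0}^{m} t^{m−2j} ∈ ℤ[t,t⁻¹]. -/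
open LaurentPolynomial

/-- `χ m = Σ_{j=0}^{m} t^{m−2j}`, the character of the irreducible `SU(2)`-representation
of highest weight `m`, as a Laurent polynomial. -/
noncomputable def chiSU2 (m : ℕ) : LaurentPolynomial ℤ :=
  ∑ j ∈ Finset.range (m + 1), T ((m : ℤ) - 2 * j)

theorem T_sub_T_mul_chiSU2 (m : ℕ) :
    (T 1 - T (-1)) * chiSU2 m = T ((m : ℤ) + 1) - T (-((m : ℤ) + 1)) := by
  have h (j : ℕ) : (T 1 - T (-1) : LaurentPolynomial ℤ) * T ((m : ℤ) - 2 * j) =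
      T ((m : ℤ) + 1 - 2 * j) - T ((m : ℤ) + 1 - 2 * (j + 1 : ℕ)) := by
    rw [sub_mul, ← T_add, ← T_add]
    congr 2 <;> push_cast <;> ring
  rw [chiSU2, Finset.mul_sum, Finset.sum_congr rfl fun j _ => h j,
    Finset.sum_range_sub' fun j : ℕ => (T ((m : ℤ) + 1 - 2 * j) : LaurentPolynomial ℤ)]
  congr 2 <;> push_cast <;> ring

theorem prod_one_add_C_mul_T {ι R : Type*} [CommRing R] (s : Finset ι) (b : ι → R) (n : ℤ) :
    ∏ i ∈ s, (1 + C (b i) * T n) =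
      ∑ l ∈ Finset.range (s.card + 1),
        C (∑ I ∈ Finset.powersetCard l s, ∏ i ∈ I, b i) * T (l * n) := by
  rw [Finset.prod_one_add, Finset.sum_powerset]
  refine Finset.sum_congr rfl fun l _ => ?_
  rw [map_sum, Finset.sum_mul]
  refine Finset.sum_congr rfl fun I hI => ?_
  rw [Finset.prod_mul_distrib, Finset.prod_const, (Finset.mem_powersetCard.mp hI).2, T_pow,
    map_prod]

/-- For integers `b₁, …, b_k`:
`∏ (1 + bᵢ t) − ∏ (1 + bᵢ t⁻¹) = (t − t⁻¹) · Σ_{ℓ=1}^{k} e_ℓ(b) · χ_{ℓ−1}` in `ℤ[t,t⁻¹]`,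
where `e_ℓ` is the `ℓ`-th elementary symmetric polynomial. -/
theorem prod_sub_prod_eq (k : ℕ) (hk : 1 ≤ k) (b : Fin k → ℤ) :
    (∏ i, (1 + C (b i) * T 1)) - (∏ i, (1 + C (b i) * T (-1))) =
      (T 1 - T (-1)) *
        ∑ ℓ ∈ Finset.Icc 1 k,
          C (∑ I ∈ Finset.powersetCard ℓ (Finset.univ : Finset (Fin k)), ∏ i ∈ I, b i) *
            chiSU2 (ℓ - 1) := by
  rw [prod_one_add_C_mul_T, prod_one_add_C_mul_T, ← Finset.sum_sub_distrib, Finset.card_fin,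
    Finset.mul_sum]
  symm
  refine Finset.sum_subset_zero_on_sdiff (fun l hl => ?_) (fun l hl => ?_) (fun l hl => ?_)
  · simp only [Finset.mem_Icc, Finset.mem_range] at hl ⊢
    omega
  · have hl0 : l = 0 := by
      simp only [Finset.mem_sdiff, Finset.mem_Icc, Finset.mem_range] at hl
      omega
    simp [hl0]
  · obtain ⟨m, rfl⟩ := Nat.exists_eq_add_of_le' (Finset.mem_Icc.mp hl).1
    rw [mul_left_comm, Nat.add_sub_cancel, T_sub_T_mul_chiSU2, ← mul_sub]
    push_cast
    rw [mul_one, mul_neg_one]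
end

section
/- Let f ∈ ℚ[X] be a polynomial of degree at least 1. Let A = ℚ[t₁^{±1}, t₂^{±1}] be the Laurent polynomial ring in two variables over ℚ, set t₃ := t₁⁻¹·t₂⁻¹ ∈ A, and let R be the localization of A at the multiplicative set generated by the single element f(t₁)·f(t₂)·f(t₃). Then the images in R of f(t₂) − f(t₁) and f(t₃) − f(t₂) form a regular sequence in R; that is, f(t₂) − f(t₁) is a nonzerodivisor on R, and f(t₃) − f(t₂) is a nonzerodivisor on the quotient R/(f(t₂) − f(t₁)). -/
noncomputable section

/-- `A = ℚ[t₁^{±1}, t₂^{±1}]`, the Laurent polynomial ring in two variables over ℚ,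
realized as the group algebra of `ℤ × ℤ` over `ℚ`. -/
abbrev LaurentTwo : Type := AddMonoidAlgebra ℚ (ℤ × ℤ)

/-- The variable `t₁`. -/
def t₁ : LaurentTwo := AddMonoidAlgebra.of' ℚ (ℤ × ℤ) (1, 0)

/-- The variable `t₂`. -/
def t₂ : LaurentTwo := AddMonoidAlgebra.of' ℚ (ℤ × ℤ) (0, 1)

/-- `t₃ = t₁⁻¹·t₂⁻¹`. -/
def t₃ : LaurentTwo := AddMonoidAlgebra.of' ℚ (ℤ × ℤ) (-1, -1)

/-- `R`, the localization of `A` at the multiplicative set generated by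
`f(t₁)·f(t₂)·f(t₃)`; this is the rationalized localized representation ring
`R_F(𝕋²) ⊗ ℚ` of the maximal torus of `SU(3)`. -/
abbrev LocLaurentTwo (f : Polynomial ℚ) : Type :=
  Localization.Away (Polynomial.aeval t₁ f * Polynomial.aeval t₂ f * Polynomial.aeval t₃ f)

/-- The image of `f(t₂) − f(t₁)` in `R`. -/
def x₁ (f : Polynomial ℚ) : LocLaurentTwo f :=
  algebraMap LaurentTwo (LocLaurentTwo f) (Polynomial.aeval t₂ f - Polynomial.aeval t₁ f)

/-- The image of `f(t₃) − f(t₂)` in `R`. -/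
def x₂ (f : Polynomial ℚ) : LocLaurentTwo f :=
  algebraMap LaurentTwo (LocLaurentTwo f) (Polynomial.aeval t₃ f - Polynomial.aeval t₂ f)

/-- The span of the monomials in `x`, `y`, `z` of total degree less than `d`. -/
def monomialSpan (K : Type*) {E : Type*} [Field K] [CommRing E] [Algebra K E] (x y z : E) (d : ℕ) :
    Submodule K E :=
  Submodule.span K {m | ∃ i j k : ℕ, i + j + k < d ∧ m = x ^ i * y ^ j * z ^ k}

section monomialSpan

open Polynomial

variable {K E : Type*} [Field K] [CommRing E] [Algebra K E] {x y z : E}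

lemma monomial_mem_monomialSpan {i j k d : ℕ} (h : i + j + k < d) :
    x ^ i * y ^ j * z ^ k ∈ monomialSpan K x y z d :=
  Submodule.subset_span ⟨i, j, k, h, rfl⟩

lemma monomialSpan_mono {d e : ℕ} (h : d ≤ e) :
    monomialSpan K x y z d ≤ monomialSpan K x y z e :=
  Submodule.span_mono fun _ ⟨i, j, k, hd, hm⟩ ↦ ⟨i, j, k, hd.trans_le h, hm⟩

lemma monomialSpan_fg (d : ℕ) : (monomialSpan K x y z d).FG := by
  refine Submodule.fg_span (Set.Finite.subset (Set.Finite.image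
    (fun p : ℕ × ℕ × ℕ ↦ x ^ p.1 * y ^ p.2.1 * z ^ p.2.2)
    ((Set.finite_Iio d).prod ((Set.finite_Iio d).prod (Set.finite_Iio d)))) ?_)
  rintro _ ⟨i, j, k, h, rfl⟩
  exact ⟨(i, j, k), by simp only [Set.mem_prod, Set.mem_Iio]; omega, rfl⟩

lemma monomial_mul_mem_monomialSpan {m : E} {d e : ℕ} (i j k : ℕ)
    (hm : m ∈ monomialSpan K x y z d) (h : i + j + k + d ≤ e) :
    x ^ i * y ^ j * z ^ k * m ∈ monomialSpan K x y z e := by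
  induction hm using Submodule.span_induction with
  | mem m hm =>
    obtain ⟨i', j', k', hd, rfl⟩ := hm
    convert monomial_mem_monomialSpan (K := K) (x := x) (y := y) (z := z)
      (i := i + i') (j := j + j') (k := k + k') (d := e) (by omega) using 1
    ring
  | zero => simp
  | add a b _ _ ha hb => rw [mul_add]; exact add_mem ha hb
  | smul c a _ ha => rw [mul_smul_comm]; exact Submodule.smul_mem _ c ha

lemma pow_sub_pow_mem_of_aeval_eq {f : K[X]} (hf : 1 ≤ f.natDegree) {u v : E}
    (huv : aeval u f = aeval v f) {W : Submodule K E} (hu : ∀ i < f.natDegree, u ^ i ∈ W)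
    (hv : ∀ i < f.natDegree, v ^ i ∈ W) : u ^ f.natDegree - v ^ f.natDegree ∈ W := by
  have hlc : f.leadingCoeff ≠ 0 := by
    rw [Ne, leadingCoeff_eq_zero]; rintro rfl; simp at hf
  rw [← Submodule.smul_mem_iff W hlc]
  have key : f.leadingCoeff • (u ^ f.natDegree - v ^ f.natDegree) =
      ∑ i ∈ Finset.range f.natDegree, f.coeff i • v ^ i -
        ∑ i ∈ Finset.range f.natDegree, f.coeff i • u ^ i := by
    rw [aeval_eq_sum_range, aeval_eq_sum_range, Finset.sum_range_succ, Finset.sum_range_succ] at huv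
    rw [smul_sub, leadingCoeff]
    linear_combination huv
  rw [key]
  refine sub_mem (sum_mem fun i hi ↦ ?_) (sum_mem fun i hi ↦ ?_)
  · exact W.smul_mem _ (hv i (Finset.mem_range.1 hi))
  · exact W.smul_mem _ (hu i (Finset.mem_range.1 hi))

/-- If a nonconstant polynomial takes the same value at `x`, `y` and `z`, and `x * y * z = 1`,
then `y` is integral over the base field. -/
theorem isIntegral_of_aeval_eq_of_mul_eq_one {f : K[X]} (hf : 1 ≤ f.natDegree)
    (hxy : aeval x f = aeval y f) (hyz : aeval y f = aeval z f) (hxyz : x * y * z = 1) :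
    IsIntegral K y := by
  set n := f.natDegree with hn
  have hx (i : ℕ) (hi : i < n) : x ^ i ∈ monomialSpan K x y z n := by
    simpa using monomial_mem_monomialSpan (K := K) (x := x) (y := y) (z := z)
      (i := i) (j := 0) (k := 0) (d := n) (by omega)
  have hy (i : ℕ) (hi : i < n) : y ^ i ∈ monomialSpan K x y z n := by
    simpa using monomial_mem_monomialSpan (K := K) (x := x) (y := y) (z := z)
      (i := 0) (j := i) (k := 0) (d := n) (by omega)
  have hz (i : ℕ) (hi : i < n) : z ^ i ∈ monomialSpan K x y z n := by
    simpa using monomial_mem_monomialSpan (K := K) (x := x) (y := y) (z := z)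
      (i := 0) (j := 0) (k := i) (d := n) (by omega)
  have dxy := pow_sub_pow_mem_of_aeval_eq hf hxy hx hy
  have dyz := pow_sub_pow_mem_of_aeval_eq hf hyz hy hz
  have dxz := pow_sub_pow_mem_of_aeval_eq hf (hxy.trans hyz) hx hz
  have h1 : (1 : E) ∈ monomialSpan K x y z (3 * n) := by
    simpa using monomial_mem_monomialSpan (K := K) (x := x) (y := y) (z := z)
      (i := 0) (j := 0) (k := 0) (d := 3 * n) (by omega)
  have hpow : x ^ n * y ^ n * z ^ n = 1 := by rw [← mul_pow, ← mul_pow, hxyz, one_pow]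
  rw [← hn] at dxy dyz dxz
  have hx3 : x ^ (3 * n) ∈ monomialSpan K x y z (3 * n) := by
    convert add_mem (add_mem (monomial_mul_mem_monomialSpan (2 * n) 0 0 dxy
      (show _ ≤ 3 * n by omega)) (monomial_mul_mem_monomialSpan n n 0 dxz
      (show _ ≤ 3 * n by omega))) h1 using 1
    linear_combination hpow
  have hy3 : y ^ (3 * n) ∈ monomialSpan K x y z (3 * n) := by
    convert add_mem (sub_mem (monomial_mul_mem_monomialSpan n n 0 dyz
      (show _ ≤ 3 * n by omega)) (monomial_mul_mem_monomialSpan 0 (2 * n) 0 dxy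
      (show _ ≤ 3 * n by omega))) h1 using 1
    linear_combination hpow
  have hz3 : z ^ (3 * n) ∈ monomialSpan K x y z (3 * n) := by
    convert sub_mem (sub_mem h1 (monomial_mul_mem_monomialSpan n 0 n dyz
      (show _ ≤ 3 * n by omega))) (monomial_mul_mem_monomialSpan 0 0 (2 * n) dxz
      (show _ ≤ 3 * n by omega)) using 1
    linear_combination hpow
  have hle (d : ℕ) : monomialSpan K x y z d ≤ monomialSpan K x y z (9 * n) := by
    induction d with
    | zero => exact monomialSpan_mono (Nat.zero_le _)
    | succ d ih =>
      refine Submodule.span_le.2 ?_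
      rintro _ ⟨i, j, k, hd, rfl⟩
      by_cases h9 : i + j + k < 9 * n
      · exact monomial_mem_monomialSpan h9
      apply ih
      obtain h | h | h : 3 * n ≤ i ∨ 3 * n ≤ j ∨ 3 * n ≤ k := by omega
      · obtain ⟨i, rfl⟩ := Nat.exists_eq_add_of_le' h
        convert monomial_mul_mem_monomialSpan i j k hx3 (show _ ≤ d by omega) using 1
        ring
      · obtain ⟨j, rfl⟩ := Nat.exists_eq_add_of_le' h
        convert monomial_mul_mem_monomialSpan i j k hy3 (show _ ≤ d by omega) using 1
        ring
      · obtain ⟨k, rfl⟩ := Nat.exists_eq_add_of_le' h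
        convert monomial_mul_mem_monomialSpan i j k hz3 (show _ ≤ d by omega) using 1
        ring
  have hadj : Subalgebra.toSubmodule (Algebra.adjoin K {y}) ≤ monomialSpan K x y z (9 * n) := by
    rw [Algebra.adjoin_eq_span, Submodule.span_le]
    intro m hm
    obtain ⟨k, rfl⟩ := Submonoid.mem_closure_singleton.1 hm
    refine hle (k + 1) ?_
    simpa using monomial_mem_monomialSpan (K := K) (x := x) (y := y) (z := z)
      (i := 0) (j := k) (k := 0) (d := k + 1) (by omega)
  have : IsNoetherian K (monomialSpan K x y z (9 * n)) :=
    isNoetherian_of_fg_of_noetherian _ (monomialSpan_fg _)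
  exact isIntegral_of_submodule_noetherian _ (isNoetherian_of_le hadj) y
    (Algebra.self_mem_adjoin_singleton K y)

end monomialSpan

section

open Polynomial LaurentPolynomial

/-- A polynomial with unit leading coefficient is a nonzerodivisor modulo every constant. -/
lemma Polynomial.C_dvd_of_C_dvd_mul {S : Type*} [CommRing S] {k : S} {p q : S[X]}
    (hp : IsUnit p.leadingCoeff) (h : Polynomial.C k ∣ p * q) : Polynomial.C k ∣ q := by
  rw [Polynomial.C_dvd_iff_dvd_coeff] at h ⊢
  let π := Ideal.Quotient.mk (Ideal.span {k})
  have hpq : p.map π * q.map π = 0 := by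
    ext i
    rw [← Polynomial.map_mul, coeff_map, coeff_zero]
    exact Ideal.Quotient.eq_zero_iff_mem.2 (Ideal.mem_span_singleton.2 (h i))
  have hu : IsUnit (p.map π).leadingCoeff := by
    cases subsingleton_or_nontrivial (S ⧸ Ideal.span {k})
    · exact isUnit_of_subsingleton _
    · rw [leadingCoeff_map_eq_of_isUnit_leadingCoeff _ hp]
      exact hp.map π
  rw [isUnit_leadingCoeff_mul_right_eq_zero_iff hu] at hpq
  intro i
  have := congrArg (fun r ↦ r.coeff i) hpq
  simpa [π, Ideal.Quotient.eq_zero_iff_mem, Ideal.mem_span_singleton] using this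

/-- A polynomial with unit leading coefficient is a nonzerodivisor modulo every constant in the
ring of Laurent polynomials. -/
lemma LaurentPolynomial.C_dvd_of_C_dvd_toLaurent_mul {S : Type*} [CommRing S] {k : S} {p : S[X]}
    {s : S[T;T⁻¹]} (hp : IsUnit p.leadingCoeff)
    (h : LaurentPolynomial.C k ∣ toLaurent p * s) : LaurentPolynomial.C k ∣ s := by
  obtain ⟨r, hr⟩ := h
  obtain ⟨m, s', hs⟩ := exists_T_pow s
  obtain ⟨l, r', hr'⟩ := exists_T_pow r
  have key : p * (X ^ l * s') = Polynomial.C k * (X ^ m * r') := by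
    apply toLaurent_injective
    simp only [map_mul, hs, hr', toLaurent_X_pow, toLaurent_C]
    linear_combination (T l * T m) * hr
  obtain ⟨q, hq⟩ := Polynomial.C_dvd_of_C_dvd_mul hp ⟨_, key⟩
  have hs2 := congrArg toLaurent hq
  simp only [map_mul, hs, toLaurent_X_pow, toLaurent_C] at hs2
  have hT : IsUnit (T l * T m : S[T;T⁻¹]) := (isUnit_T _).mul (isUnit_T _)
  rw [← hT.dvd_mul_left]
  exact ⟨_, by rw [← hs2]; ring⟩

end

section LaurentTwo

open Polynomial LaurentPolynomial

lemma t₁_mul_t₂_mul_t₃ : t₁ * t₂ * t₃ = 1 := by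
  simp [t₁, t₂, t₃, AddMonoidAlgebra.of'_apply, AddMonoidAlgebra.single_mul_single,
    AddMonoidAlgebra.one_def, ← Prod.zero_eq_mk]

/-- Two-variable Laurent polynomials as Laurent polynomials in `t₁` over those in `t₂`. -/
def laurentTwoEquiv : LaurentTwo ≃ₐ[ℚ] ℚ[T;T⁻¹][T;T⁻¹] :=
  AddMonoidAlgebra.curryAlgEquiv ℚ

lemma laurentTwoEquiv_t₁ : laurentTwoEquiv t₁ = toLaurent X := by
  rw [toLaurent_X]
  exact AddMonoidAlgebra.curryAlgEquiv_single _ _ _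

lemma laurentTwoEquiv_t₂ : laurentTwoEquiv t₂ = LaurentPolynomial.C (T 1) :=
  AddMonoidAlgebra.curryAlgEquiv_single _ _ _

lemma laurentTwoEquiv_aeval_t₁ (f : ℚ[X]) :
    laurentTwoEquiv (aeval t₁ f) = toLaurent (f.map (algebraMap ℚ ℚ[T;T⁻¹])) := by
  have : laurentTwoEquiv (aeval t₁ f) = toLaurent (aeval (X : ℚ[T;T⁻¹][X]) f) := by
    induction f using Polynomial.induction_on' with
    | add p q hp hq => simp [hp, hq]
    | monomial n a =>
      simp only [aeval_monomial, map_mul, map_pow, laurentTwoEquiv_t₁, AlgEquiv.commutes]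
      congr 1
      rw [IsScalarTower.algebraMap_apply ℚ ℚ[T;T⁻¹] ℚ[T;T⁻¹][X], Polynomial.algebraMap_apply,
        toLaurent_C]
      rfl
  rw [this, aeval_X_left_eq_map]

lemma laurentTwoEquiv_aeval_t₂ (f : ℚ[X]) :
    laurentTwoEquiv (aeval t₂ f) = LaurentPolynomial.C (toLaurent f) := by
  induction f using Polynomial.induction_on' with
  | add p q hp hq => simp [hp, hq]
  | monomial n a =>
    rw [aeval_monomial, map_mul, map_pow, laurentTwoEquiv_t₂, AlgEquiv.commutes,
      ← Polynomial.C_mul_X_pow_eq_monomial, map_mul, map_pow, toLaurent_C, toLaurent_X, map_mul,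
      map_pow]
    rfl

lemma laurentTwoEquiv_aeval_sub (f : ℚ[X]) :
    laurentTwoEquiv (aeval t₂ f - aeval t₁ f) =
      toLaurent (Polynomial.C (toLaurent f) - f.map (algebraMap ℚ ℚ[T;T⁻¹])) := by
  simp [laurentTwoEquiv_aeval_t₁, laurentTwoEquiv_aeval_t₂]

lemma isUnit_leadingCoeff_C_sub_map {f : ℚ[X]} (hf : 1 ≤ f.natDegree) :
    IsUnit (Polynomial.C (toLaurent f) - f.map (algebraMap ℚ ℚ[T;T⁻¹])).leadingCoeff := by
  have hinj : Function.Injective (algebraMap ℚ ℚ[T;T⁻¹]) := FaithfulSMul.algebraMap_injective _ _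
  have hlc : f.leadingCoeff ≠ 0 := by
    rw [Ne, leadingCoeff_eq_zero]; rintro rfl; simp at hf
  rw [leadingCoeff_sub_of_degree_lt', leadingCoeff_map_of_injective hinj]
  · exact (hlc.isUnit.map _).neg
  · rw [degree_map_eq_of_injective hinj]
    exact degree_C_le.trans_lt (natDegree_pos_iff_degree_pos.1 hf)

lemma aeval_t₂_sub_aeval_t₁_ne_zero {f : ℚ[X]} (hf : 1 ≤ f.natDegree) :
    aeval t₂ f - aeval t₁ f ≠ 0 := by
  intro h
  have := laurentTwoEquiv_aeval_sub f
  rw [h, map_zero, eq_comm, toLaurent_eq_zero] at this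
  simpa [this] using isUnit_leadingCoeff_C_sub_map hf

/-- `f(t₂) - f(t₁)` is a nonzerodivisor modulo every element `g(t₂)`. -/
lemma aeval_t₂_dvd_of_dvd_mul {f g : ℚ[X]} (hf : 1 ≤ f.natDegree) {s : LaurentTwo}
    (h : aeval t₂ g ∣ (aeval t₂ f - aeval t₁ f) * s) : aeval t₂ g ∣ s := by
  rw [← map_dvd_iff laurentTwoEquiv] at h ⊢
  rw [map_mul, laurentTwoEquiv_aeval_sub, laurentTwoEquiv_aeval_t₂] at h
  rw [laurentTwoEquiv_aeval_t₂]
  exact LaurentPolynomial.C_dvd_of_C_dvd_toLaurent_mul (isUnit_leadingCoeff_C_sub_map hf) h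

/-- Some `g(t₂)` with `g ≠ 0` lies in the ideal generated by the two differences. -/
lemma exists_aeval_t₂_mem_span {f : ℚ[X]} (hf : 1 ≤ f.natDegree) :
    ∃ g : ℚ[X], g ≠ 0 ∧ aeval t₂ g ∈
      Ideal.span {aeval t₂ f - aeval t₁ f, aeval t₃ f - aeval t₂ f} := by
  set I := Ideal.span {aeval t₂ f - aeval t₁ f, aeval t₃ f - aeval t₂ f} with hI
  let π := Ideal.Quotient.mkₐ ℚ I
  have h12 : aeval (π t₁) f = aeval (π t₂) f := by
    rw [aeval_algHom_apply, aeval_algHom_apply, eq_comm]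
    exact Ideal.Quotient.eq.2 (Ideal.subset_span (by simp))
  have h23 : aeval (π t₂) f = aeval (π t₃) f := by
    rw [aeval_algHom_apply, aeval_algHom_apply, eq_comm]
    exact Ideal.Quotient.eq.2 (Ideal.subset_span (by simp))
  obtain ⟨g, hg, hg0⟩ := isIntegral_of_aeval_eq_of_mul_eq_one hf h12 h23
    (by rw [← map_mul, ← map_mul, t₁_mul_t₂_mul_t₃, map_one])
  refine ⟨g, hg.ne_zero, ?_⟩
  rw [← aeval_def, aeval_algHom_apply] at hg0
  exact Ideal.Quotient.eq_zero_iff_mem.1 hg0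

lemma dvd_of_dvd_aeval_sub_mul {f : ℚ[X]} (hf : 1 ≤ f.natDegree) {r : LaurentTwo}
    (h : aeval t₂ f - aeval t₁ f ∣ (aeval t₃ f - aeval t₂ f) * r) :
    aeval t₂ f - aeval t₁ f ∣ r := by
  obtain ⟨g, hg, hmem⟩ := exists_aeval_t₂_mem_span hf
  obtain ⟨α, β, hαβ⟩ := Ideal.mem_span_pair.1 hmem
  obtain ⟨s, hs⟩ := h
  have hgr : aeval t₂ g * r = (aeval t₂ f - aeval t₁ f) * (α * r + β * s) := by
    rw [← hαβ]
    linear_combination β * hs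
  obtain ⟨s', hs'⟩ := aeval_t₂_dvd_of_dvd_mul hf ⟨r, hgr.symm⟩
  have hg0 : aeval t₂ g ≠ 0 := by
    rw [Ne, ← map_eq_zero_iff laurentTwoEquiv laurentTwoEquiv.injective, laurentTwoEquiv_aeval_t₂,
      LaurentPolynomial.C_eq_algebraMap, map_eq_zero_iff _ (FaithfulSMul.algebraMap_injective ℚ[T;T⁻¹] ℚ[T;T⁻¹][T;T⁻¹]),
      toLaurent_eq_zero]
    exact hg
  refine ⟨s', mul_left_cancel₀ hg0 ?_⟩
  rw [hgr, hs']
  ring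

end LaurentTwo

/-- Divisibility in a localization can be tested before localizing, up to the submonoid. -/
lemma IsLocalization.exists_dvd_mul_of_map_dvd {A B : Type*} [CommRing A] [CommRing B] [Algebra A B]
    (M : Submonoid A) [IsLocalization M B] {a b : A}
    (h : algebraMap A B a ∣ algebraMap A B b) : ∃ m : M, a ∣ m * b := by
  obtain ⟨s, hs⟩ := h
  obtain ⟨⟨s₀, m⟩, hm⟩ := IsLocalization.surj M s
  have : algebraMap A B (m * b) = algebraMap A B (a * s₀) := by
    rw [map_mul, map_mul, hs, ← hm]
    ring
  obtain ⟨c, hc⟩ := (IsLocalization.eq_iff_exists M B).1 this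
  refine ⟨c * m, c * s₀, ?_⟩
  rw [Submonoid.coe_mul, mul_assoc, hc]
  ring

/-- For a polynomial `f` of degree at least 1, the images of `f(t₂) − f(t₁)` and
`f(t₃) − f(t₂)` form a regular sequence in `R`: the first is a nonzerodivisor on `R` and
the second is a nonzerodivisor on `R/(f(t₂) − f(t₁))`. -/
theorem regular_sequence (f : Polynomial ℚ) (hf : 1 ≤ f.natDegree) :
    (∀ r : LocLaurentTwo f, x₁ f * r = 0 → r = 0) ∧
    (∀ r : LocLaurentTwo f ⧸ Ideal.span {x₁ f},
      Ideal.Quotient.mk (Ideal.span {x₁ f}) (x₂ f) * r = 0 → r = 0) := by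
  set M := Submonoid.powers
    (Polynomial.aeval t₁ f * Polynomial.aeval t₂ f * Polynomial.aeval t₃ f)
  constructor
  · intro r hr
    obtain ⟨⟨r₀, m⟩, hm⟩ := IsLocalization.surj M r
    have hu := IsLocalization.map_units (LocLaurentTwo f) m
    have h0 : algebraMap LaurentTwo (LocLaurentTwo f)
        ((Polynomial.aeval t₂ f - Polynomial.aeval t₁ f) * r₀) = 0 := by
      rw [map_mul, ← hm, ← mul_assoc]
      exact (congrArg (· * _) hr).trans (zero_mul _)
    obtain ⟨c, hc⟩ := (IsLocalization.map_eq_zero_iff M _ _).1 h0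
    have hcr : (c : LaurentTwo) * r₀ = 0 := by
      refine mul_left_cancel₀ (aeval_t₂_sub_aeval_t₁_ne_zero hf) ?_
      rw [mul_zero, ← hc]
      ring
    rw [← hu.mul_left_eq_zero, hm]
    exact (IsLocalization.map_eq_zero_iff M _ _).2 ⟨c, hcr⟩
  · intro r hr
    obtain ⟨r, rfl⟩ := Ideal.Quotient.mk_surjective r
    rw [← map_mul, Ideal.Quotient.eq_zero_iff_mem, Ideal.mem_span_singleton] at hr
    rw [Ideal.Quotient.eq_zero_iff_mem, Ideal.mem_span_singleton]
    obtain ⟨⟨r₀, m⟩, hm⟩ := IsLocalization.surj M r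
    have hu := IsLocalization.map_units (LocLaurentTwo f) m
    have hdvd : algebraMap LaurentTwo (LocLaurentTwo f)
        (Polynomial.aeval t₂ f - Polynomial.aeval t₁ f) ∣ algebraMap LaurentTwo (LocLaurentTwo f)
        ((Polynomial.aeval t₃ f - Polynomial.aeval t₂ f) * r₀) := by
      rw [map_mul, ← hm, ← mul_assoc]
      exact hr.mul_right _
    obtain ⟨c, hc⟩ := IsLocalization.exists_dvd_mul_of_map_dvd M hdvd
    have hcr := dvd_of_dvd_aeval_sub_mul hf (r := c * r₀) (by rwa [mul_left_comm] at hc)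
    have := map_dvd (algebraMap LaurentTwo (LocLaurentTwo f)) hcr
    rw [map_mul, (IsLocalization.map_units (LocLaurentTwo f) c).dvd_mul_left, ← hm,
      hu.dvd_mul_right] at this
    exact this
end
end
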